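/- Let Φ be a simple, stationary point process on ℝ^d of intensity λ that is α-weakly sub-Poisson, and let ℓ: ℝ^d × ℝ^d → [0,∞) be a measurable response function with shot-noise field V_Φ(y) = Σ_{X∈Φ} ℓ(X,y). Then for any y_1,…,y_m ∈ ℝ^d and any s, h > 0: P(V_Φ(y_i) ≥ h for all 1 ≤ i ≤ m) ≤ e^{−smh} · exp( λ ∫_{ℝ^d} ( e^{s Σ_{i=1}^m ℓ(x,y_i)} − 1 ) dx ). -/

import Mathlib

open MeasureTheory ENNReal Metric

noncomputable section

/-- Extended exponential `e^x` on `ℝ≥0∞` (with `e^∞ = ∞`). -/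
def expE (x : ℝ≥0∞) : ℝ≥0∞ := if x = ∞ then ∞ else ENNReal.ofReal (Real.exp x.toReal)

/-- The additive shot-noise field `V_Φ(y) = Σ_{X ∈ Φ} ℓ(X, y)` generated by a
counting measure `μ` and a nonnegative response function `ℓ`. -/
def shotNoise {d : ℕ} (μ : Measure (EuclideanSpace ℝ (Fin d)))
    (ℓ : EuclideanSpace ℝ (Fin d) → EuclideanSpace ℝ (Fin d) → ℝ)
    (y : EuclideanSpace ℝ (Fin d)) : ℝ≥0∞ :=
  ∫⁻ x, ENNReal.ofReal (ℓ x y) ∂μ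

open Filter Topology

lemma expE_eq_ereal_exp (x : ℝ≥0∞) : expE x = EReal.exp (x : EReal) := by
  induction x with
  | top => simp [expE]
  | coe x => simp [expE, EReal.coe_nnreal_eq_coe_real]

lemma expE_ofReal {x : ℝ} (hx : 0 ≤ x) :
    expE (ENNReal.ofReal x) = ENNReal.ofReal (Real.exp x) := by
  simp [expE, ENNReal.toReal_ofReal hx]

@[simp] lemma expE_zero : expE 0 = 1 := by simp [expE]

lemma expE_add (x y : ℝ≥0∞) : expE (x + y) = expE x * expE y := by
  simp [expE_eq_ereal_exp, EReal.exp_add]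

lemma expE_sum {ι : Type*} (t : Finset ι) (f : ι → ℝ≥0∞) :
    expE (∑ i ∈ t, f i) = ∏ i ∈ t, expE (f i) := by
  classical
  induction t using Finset.induction_on with
  | empty => simp
  | insert a t ha ih => rw [Finset.sum_insert ha, Finset.prod_insert ha, expE_add, ih]

lemma expE_mono : Monotone expE := fun x y hxy => by
  simpa [expE_eq_ereal_exp] using hxy

lemma continuous_expE : Continuous expE := by
  simp_rw [funext expE_eq_ereal_exp]
  exact ENNReal.continuous_exp.comp continuous_coe_ennreal_ereal

lemma one_le_expE (x : ℝ≥0∞) : 1 ≤ expE x := by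
  simpa using expE_mono (zero_le (a := x))

lemma one_add_le_expE (x : ℝ≥0∞) : 1 + x ≤ expE x := by
  induction x with
  | top => simp [expE]
  | coe x =>
    rw [← ENNReal.ofReal_coe_nnreal, expE_ofReal x.coe_nonneg, ← ENNReal.ofReal_one,
      ← ENNReal.ofReal_add zero_le_one x.coe_nonneg]
    exact ENNReal.ofReal_le_ofReal (by linarith [Real.add_one_le_exp (x : ℝ)])

/-- Fatou's lemma for an almost everywhere convergent sequence with bounded integrals. -/
lemma lintegral_le_of_ae_tendsto {Ω : Type*} [MeasurableSpace Ω] {P : Measure Ω}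
    {u : ℕ → Ω → ℝ≥0∞} {v : Ω → ℝ≥0∞} {C : ℝ≥0∞} (hu : ∀ n, Measurable (u n))
    (huv : ∀ᵐ ω ∂P, Tendsto (fun n => u n ω) atTop (𝓝 (v ω)))
    (hC : ∀ n, ∫⁻ ω, u n ω ∂P ≤ C) : ∫⁻ ω, v ω ∂P ≤ C :=
  calc ∫⁻ ω, v ω ∂P = ∫⁻ ω, liminf (fun n => u n ω) atTop ∂P :=
        lintegral_congr_ae (huv.mono fun _ h => h.liminf_eq.symm)
    _ ≤ liminf (fun n => ∫⁻ ω, u n ω ∂P) atTop := lintegral_liminf_le hu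
    _ ≤ C := (liminf_le_liminf (Eventually.of_forall hC)).trans (liminf_const C).le

lemma measurable_measure_restrict {α : Type*} [MeasurableSpace α] {A : Set α}
    (hA : MeasurableSet A) : Measurable fun μ : Measure α => μ.restrict A :=
  Measure.measurable_of_measurable_coe _ fun B hB => by
    simp_rw [Measure.restrict_apply hB]
    exact Measure.measurable_coe (hB.inter hA)

/-- A simple finite counting measure charges every cell of a fine enough partition at most once. -/
lemma eventually_measure_cylinder_le_one {α : Type*} [MeasurableSpace α] (μ : Measure α)
    (hμ : ∀ A, MeasurableSet A → ∃ n : ℕ, μ A = n) (hsimple : ∀ x, μ {x} ≤ 1)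
    {q : α → ℕ → Bool} (hq : Measurable q) (hinj : Function.Injective q) :
    ∀ᶠ n in atTop, ∀ x, μ {z | ∀ i : Fin n, q z i = q x i} ≤ 1 := by
  let p : ∀ n, α → (Fin n → Bool) := fun n x i => q x i
  have hp : ∀ n, Measurable (p n) := fun n =>
    measurable_pi_lambda _ fun i => (measurable_pi_apply _).comp hq
  let C : ℕ → α → Set α := fun n x => p n ⁻¹' {p n x}
  have hC : ∀ n x, {z | ∀ i : Fin n, q z i = q x i} = C n x := fun n x => by
    ext z; simp [C, p, funext_iff]
  simp_rw [hC]
  have hfin : ∀ A, μ A ≠ ∞ := fun A => by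
    obtain ⟨n, hn⟩ := hμ _ MeasurableSet.univ
    exact ((measure_mono (Set.subset_univ A)).trans_lt (hn ▸ ENNReal.natCast_lt_top n)).ne
  have hCmeas : ∀ n x, MeasurableSet (C n x) := fun n x => hp n (measurableSet_singleton _)
  have hCanti : ∀ x, Antitone (C · x) := fun x m n hmn z hz => by
    simp only [← hC] at hz ⊢
    exact fun i => hz (Fin.castLE hmn i)
  have hle : ∀ A, MeasurableSet A → μ A < 2 → μ A ≤ 1 := fun A hA h => by
    obtain ⟨n, hn⟩ := hμ A hA
    rw [hn] at h ⊢
    have : n < 2 := by exact_mod_cast h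
    exact_mod_cast Nat.le_of_lt_succ this
  let E : ℕ → Set α := fun n => {x | 1 < μ (C n x)}
  have hE : ∀ n, MeasurableSet (E n) := fun n =>
    hp n (MeasurableSet.of_discrete (s := {c | 1 < μ (p n ⁻¹' {c})}))
  have hEanti : Antitone E := fun m n hmn x hx =>
    lt_of_lt_of_le hx (measure_mono (hCanti x hmn))
  have hEempty : ⋂ n, E n = ∅ := by
    refine Set.eq_empty_of_forall_notMem fun x hx => ?_
    rw [Set.mem_iInter] at hx
    have hinter : ⋂ n, C n x = {x} := by
      ext z
      simp only [Set.mem_iInter, Set.mem_singleton_iff]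
      refine ⟨fun h => hinj (funext fun i => ?_), fun h n => by simp [C, h]⟩
      have := h (i + 1)
      rw [← hC] at this
      exact this ⟨i, i.lt_succ_self⟩
    have ht := tendsto_measure_iInter_atTop (μ := μ) (fun n => (hCmeas n x).nullMeasurableSet)
      (hCanti x) ⟨0, hfin _⟩
    rw [hinter] at ht
    obtain ⟨n, hn⟩ := (ht.eventually_lt_const
      ((hsimple x).trans_lt ENNReal.one_lt_two)).exists
    exact (hx n).not_ge (hle _ (hCmeas n x) hn)
  have ht := tendsto_measure_iInter_atTop (μ := μ) (fun n => (hE n).nullMeasurableSet)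
    hEanti ⟨0, hfin _⟩
  rw [hEempty, measure_empty] at ht
  filter_upwards [ht.eventually_lt_const one_pos] with n hn x
  by_contra! hx
  refine (hx.trans_le (measure_mono fun z hz => ?_)).not_ge hn.le
  have hz' : p n z = p n x := hz
  simpa only [E, C, Set.mem_ofPred_eq, hz'] using hx

section SubPoisson

variable {Ω α : Type*} [MeasurableSpace Ω] [MeasurableSpace α] {P : Measure Ω}
  {Φ : Ω → Measure α} {ν : Measure α}

lemma lintegral_prod_one_add_le_expE_sum (hΦ : Measurable Φ)
    (hsub : ∀ (k : ℕ) (B : Fin k → Set α), (∀ i, MeasurableSet (B i)) →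
      Pairwise (Function.onFun Disjoint B) → ∫⁻ ω, ∏ i, Φ ω (B i) ∂P ≤ ∏ i, ν (B i))
    {ι : Type*} (t : Finset ι) (a : ι → ℝ≥0∞) (B : ι → Set α)
    (hB : ∀ i, MeasurableSet (B i)) (hdisj : Pairwise (Function.onFun Disjoint B)) :
    ∫⁻ ω, ∏ i ∈ t, (1 + a i * Φ ω (B i)) ∂P ≤ expE (∑ i ∈ t, a i * ν (B i)) := by
  have hmeas : ∀ i, Measurable fun ω => Φ ω (B i) := fun i =>
    (Measure.measurable_coe (hB i)).comp hΦ
  have hfin : ∀ u : Finset ι, ∫⁻ ω, ∏ i ∈ u, Φ ω (B i) ∂P ≤ ∏ i ∈ u, ν (B i) := fun u => by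
    have h := hsub u.card (fun j => B (u.equivFin.symm j)) (fun j => hB _)
      (fun i j hij => hdisj fun h => hij (u.equivFin.symm.injective (Subtype.ext h)))
    have hprod : ∀ g : ι → ℝ≥0∞, ∏ j, g (u.equivFin.symm j) = ∏ i ∈ u, g i := fun g => by
      rw [u.equivFin.symm.prod_comp (fun i : u => g i), Finset.prod_coe_sort u g]
    simpa only [hprod (fun i => ν (B i)), fun ω => hprod (fun i => Φ ω (B i))] using h
  calc ∫⁻ ω, ∏ i ∈ t, (1 + a i * Φ ω (B i)) ∂P
      = ∑ u ∈ t.powerset, (∏ i ∈ u, a i) * ∫⁻ ω, ∏ i ∈ u, Φ ω (B i) ∂P := by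
        simp_rw [Finset.prod_one_add, Finset.prod_mul_distrib]
        rw [lintegral_finsetSum _ fun u _ =>
          (Finset.measurable_prod u fun i _ => hmeas i).const_mul _]
        exact Finset.sum_congr rfl fun u _ =>
          lintegral_const_mul _ (Finset.measurable_prod u fun i _ => hmeas i)
    _ ≤ ∑ u ∈ t.powerset, (∏ i ∈ u, a i) * ∏ i ∈ u, ν (B i) := by
        gcongr with u; exact hfin u
    _ = ∏ i ∈ t, (1 + a i * ν (B i)) := by
        simp_rw [Finset.prod_one_add, Finset.prod_mul_distrib]
    _ ≤ expE (∑ i ∈ t, a i * ν (B i)) := by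
        rw [expE_sum]
        exact Finset.prod_le_prod' fun i _ => one_add_le_expE _

variable [MeasurableSpace.CountablyGenerated α] [MeasurableSpace.SeparatesPoints α]

lemma lintegral_expE_simpleFunc_le (hΦ : Measurable Φ)
    (hcount : ∀ᵐ ω ∂P, ∀ A, MeasurableSet A → ∃ n : ℕ, Φ ω A = n)
    (hsimple : ∀ᵐ ω ∂P, ∀ x, Φ ω {x} ≤ 1)
    (hsub : ∀ (k : ℕ) (B : Fin k → Set α), (∀ i, MeasurableSet (B i)) →
      Pairwise (Function.onFun Disjoint B) → ∫⁻ ω, ∏ i, Φ ω (B i) ∂P ≤ ∏ i, ν (B i))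
    (φ : SimpleFunc α ℝ≥0∞) :
    ∫⁻ ω, expE (∫⁻ x, φ x ∂Φ ω) ∂P ≤ expE (∫⁻ x, (expE (φ x) - 1) ∂ν) := by
  let q := MeasurableSpace.mapNatBool α
  have hq : Measurable q := MeasurableSpace.measurable_mapNatBool α
  have hinj : Function.Injective q := MeasurableSpace.injective_mapNatBool α
  let p : ∀ n, SimpleFunc α (Fin n → Bool) := fun n =>
    (SimpleFunc.ofFinite id).comp (fun x i => q x i)
      (measurable_pi_lambda _ fun i => (measurable_pi_apply _).comp hq)
  let ψ : ∀ n, SimpleFunc α (ℝ≥0∞ × (Fin n → Bool)) := fun n => φ.pair (p n)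
  have hsum : ∀ (n : ℕ) (g : ℝ≥0∞ → ℝ≥0∞) (μ : Measure α),
      ∫⁻ x, g (φ x) ∂μ = ∑ c ∈ (ψ n).range, g c.1 * μ (ψ n ⁻¹' {c}) := fun n g μ => by
    rw [← SimpleFunc.map_lintegral (fun c : ℝ≥0∞ × (Fin n → Bool) => g c.1) (ψ n),
      ← SimpleFunc.lintegral_eq_lintegral]
    rfl
  have hcell : ∀ n (c : ℝ≥0∞ × (Fin n → Bool)), MeasurableSet (ψ n ⁻¹' {c}) := fun n c =>
    (ψ n).measurableSet_fiber c
  refine lintegral_le_of_ae_tendsto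
    (u := fun n ω => ∏ c ∈ (ψ n).range, (1 + (expE c.1 - 1) * Φ ω (ψ n ⁻¹' {c})))
    (fun n => Finset.measurable_prod _ fun c _ =>
      (((Measure.measurable_coe (hcell n c)).comp hΦ).const_mul _).const_add _) ?_ fun n => ?_
  · filter_upwards [hcount, hsimple] with ω hω hω'
    refine tendsto_const_nhds.congr' ?_
    filter_upwards [eventually_measure_cylinder_le_one (Φ ω) hω hω' hq hinj] with n hn
    rw [show ∫⁻ x, φ x ∂Φ ω = _ from hsum n id (Φ ω), expE_sum]
    refine Finset.prod_congr rfl fun c hc => ?_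
    obtain ⟨x, rfl⟩ := SimpleFunc.mem_range.1 hc
    have hle : Φ ω (ψ n ⁻¹' {ψ n x}) ≤ 1 := (measure_mono fun z hz i => by
      exact congrFun (congrArg Prod.snd (Set.mem_singleton_iff.1 hz)) i).trans (hn x)
    obtain ⟨k, hk⟩ := hω _ (hcell n (ψ n x))
    rw [hk] at hle ⊢
    have hk1 : k ≤ 1 := by exact_mod_cast hle
    interval_cases k
    · simp
    · simp [add_tsub_cancel_of_le (one_le_expE _)]
  · rw [hsum n (fun v => expE v - 1)]
    exact lintegral_prod_one_add_le_expE_sum hΦ hsub _ _ _ (hcell n)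
      fun c c' hcc => Disjoint.preimage _ (Set.disjoint_singleton.2 hcc)

/-- Bound on exponential moments of linear functionals of a simple finite sub-Poisson process. -/
lemma lintegral_expE_le (hΦ : Measurable Φ)
    (hcount : ∀ᵐ ω ∂P, ∀ A, MeasurableSet A → ∃ n : ℕ, Φ ω A = n)
    (hsimple : ∀ᵐ ω ∂P, ∀ x, Φ ω {x} ≤ 1)
    (hsub : ∀ (k : ℕ) (B : Fin k → Set α), (∀ i, MeasurableSet (B i)) →
      Pairwise (Function.onFun Disjoint B) → ∫⁻ ω, ∏ i, Φ ω (B i) ∂P ≤ ∏ i, ν (B i))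
    {f : α → ℝ≥0∞} (hf : Measurable f) :
    ∫⁻ ω, expE (∫⁻ x, f x ∂Φ ω) ∂P ≤ expE (∫⁻ x, (expE (f x) - 1) ∂ν) := by
  refine lintegral_le_of_ae_tendsto
    (u := fun n ω => expE (∫⁻ x, SimpleFunc.eapprox f n x ∂Φ ω))
    (fun n => continuous_expE.measurable.comp
      ((Measure.measurable_lintegral (SimpleFunc.measurable _)).comp hΦ))
    (Eventually.of_forall fun ω => (continuous_expE.tendsto _).comp
      (lintegral_tendsto_of_tendsto_of_monotone
        (fun n => (SimpleFunc.measurable _).aemeasurable)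
        (Eventually.of_forall fun x m n hmn => SimpleFunc.monotone_eapprox f hmn x)
        (Eventually.of_forall fun x => SimpleFunc.tendsto_eapprox hf x)))
    fun n => (lintegral_expE_simpleFunc_le hΦ hcount hsimple hsub _).trans
      (expE_mono (lintegral_mono fun x => tsub_le_tsub_right (expE_mono ?_) 1))
  rw [← SimpleFunc.iSup_eapprox_apply hf x]
  exact le_iSup (fun n => SimpleFunc.eapprox f n x) n

end SubPoisson

/-- Chernoff-type upper bound on the upper level-crossing probabilities
of the shot-noise field of a simple, stationary, α-weakly sub-Poisson point process
of intensity `λ`. -/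
theorem upper_level_bound_shotNoise_of_alphaWeaklySubPoisson
    {d : ℕ} {Ω : Type*} [MeasurableSpace Ω] (P : Measure Ω) [IsProbabilityMeasure P]
    (Φ : Ω → Measure (EuclideanSpace ℝ (Fin d)))
    (hΦmeas : Measurable Φ)
    -- `Φ` is a point process: almost surely a Radon counting measure
    (hcount : ∀ᵐ ω ∂P, ∀ B : Set (EuclideanSpace ℝ (Fin d)),
      MeasurableSet B → Bornology.IsBounded B → ∃ n : ℕ, Φ ω B = n)
    -- `Φ` is simple
    (hsimple : ∀ᵐ ω ∂P, ∀ x, Φ ω {x} ≤ 1)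
    -- `Φ` is stationary with intensity `lam`
    (lam : ℝ) (hlam : 0 < lam)
    (hstat : ∀ v : EuclideanSpace ℝ (Fin d),
      P.map (fun ω => (Φ ω).map (fun x => v + x)) = P.map Φ)
    (hint : ∀ B : Set (EuclideanSpace ℝ (Fin d)), MeasurableSet B →
      ∫⁻ ω, Φ ω B ∂P = ENNReal.ofReal lam * volume B)
    -- `Φ` is α-weakly sub-Poisson
    (hsub : ∀ (k : ℕ) (B : Fin k → Set (EuclideanSpace ℝ (Fin d))),
      (∀ i, MeasurableSet (B i) ∧ Bornology.IsBounded (B i)) →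
      Pairwise (Function.onFun Disjoint B) →
      ∫⁻ ω, ∏ i, Φ ω (B i) ∂P ≤ ∏ i, ∫⁻ ω, Φ ω (B i) ∂P)
    -- measurable nonnegative response function
    (ℓ : EuclideanSpace ℝ (Fin d) → EuclideanSpace ℝ (Fin d) → ℝ)
    (hℓmeas : Measurable (Function.uncurry ℓ))
    (hℓ0 : ∀ x y, 0 ≤ ℓ x y)
    (m : ℕ) (y : Fin m → EuclideanSpace ℝ (Fin d)) (s h : ℝ) (hs : 0 < s) (hh : 0 < h) :
    P {ω | ∀ i, ENNReal.ofReal h ≤ shotNoise (Φ ω) ℓ (y i)}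
      ≤ ENNReal.ofReal (Real.exp (-(s * m * h))) *
        expE (ENNReal.ofReal lam *
          ∫⁻ x : EuclideanSpace ℝ (Fin d),
            ENNReal.ofReal (Real.exp (s * ∑ i, ℓ x (y i)) - 1)) := by
  let f : EuclideanSpace ℝ (Fin d) → ℝ≥0∞ := fun x => ENNReal.ofReal (s * ∑ i, ℓ x (y i))
  have hℓy : ∀ i, Measurable fun x => ℓ x (y i) := fun i =>
    hℓmeas.comp (measurable_id.prodMk measurable_const)
  have hf : Measurable f :=
    ((Finset.measurable_sum _ fun i _ => hℓy i).const_mul s).ennreal_ofReal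
  have hsum0 : ∀ x, 0 ≤ s * ∑ i, ℓ x (y i) := fun x =>
    mul_nonneg hs.le (Finset.sum_nonneg fun i _ => hℓ0 x (y i))
  have hexp : ∀ x, expE (f x) - 1 = ENNReal.ofReal (Real.exp (s * ∑ i, ℓ x (y i)) - 1) :=
    fun x => by rw [expE_ofReal (hsum0 x), ENNReal.ofReal_sub _ zero_le_one, ENNReal.ofReal_one]
  have hmoment : ∫⁻ ω, expE (∫⁻ x, f x ∂Φ ω) ∂P ≤
      expE (∫⁻ x, (expE (f x) - 1) ∂(ENNReal.ofReal lam • volume)) := by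
    refine lintegral_le_of_ae_tendsto
      (u := fun n ω => expE (∫⁻ x in ball (0 : EuclideanSpace ℝ (Fin d)) n, f x ∂Φ ω))
      (fun n => continuous_expE.measurable.comp ((Measure.measurable_lintegral hf).comp
        ((measurable_measure_restrict measurableSet_ball).comp hΦmeas))) ?_ fun n => ?_
    · refine Eventually.of_forall fun ω => (continuous_expE.tendsto _).comp ?_
      have hmono : Monotone fun n : ℕ => ball (0 : EuclideanSpace ℝ (Fin d)) n := fun m n hmn =>
        ball_subset_ball (by exact_mod_cast hmn)
      simp_rw [← lintegral_indicator measurableSet_ball]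
      refine lintegral_tendsto_of_tendsto_of_monotone
        (fun n => (hf.indicator measurableSet_ball).aemeasurable)
        (Eventually.of_forall fun x m n hmn =>
          Set.indicator_le_indicator_of_subset (hmono hmn) (fun _ => zero_le) x)
        (Eventually.of_forall fun x => ?_)
      have h := hmono.tendsto_indicator _ f x
      rw [iUnion_ball_nat, Set.indicator_univ] at h
      exact h.mono_right (pure_le_nhds _)
    · have hB : MeasurableSet (ball (0 : EuclideanSpace ℝ (Fin d)) n) := measurableSet_ball
      refine (lintegral_expE_le (ν := (ENNReal.ofReal lam • volume).restrict (ball 0 n))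
        ((measurable_measure_restrict hB).comp hΦmeas) ?_ ?_ ?_ hf).trans
        (expE_mono (setLIntegral_le_lintegral _ _))
      · filter_upwards [hcount] with ω hω A hA
        obtain ⟨k, hk⟩ := hω _ (hA.inter hB) (isBounded_ball.subset Set.inter_subset_right)
        exact ⟨k, (Measure.restrict_apply hA).trans hk⟩
      · filter_upwards [hsimple] with ω hω x
        exact (Measure.restrict_le_self _).trans (hω x)
      · intro k B hBmeas hdisj
        have h := hsub k (fun i => B i ∩ ball (0 : EuclideanSpace ℝ (Fin d)) n)
          (fun i => ⟨(hBmeas i).inter hB, isBounded_ball.subset Set.inter_subset_right⟩)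
          (fun i j hij => (hdisj hij).mono Set.inter_subset_left Set.inter_subset_left)
        simpa only [hint _ ((hBmeas _).inter hB), Function.comp_apply,
          Measure.restrict_apply (hBmeas _), Measure.smul_apply, smul_eq_mul] using h
  simp_rw [hexp, lintegral_smul_measure, smul_eq_mul] at hmoment
  have hshot : ∀ ω, ∫⁻ x, f x ∂Φ ω = ENNReal.ofReal s * ∑ i, shotNoise (Φ ω) ℓ (y i) := fun ω => by
    simp_rw [shotNoise, f, ENNReal.ofReal_mul hs.le,
      ENNReal.ofReal_sum_of_nonneg fun i _ => hℓ0 _ (y i)]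
    rw [lintegral_const_mul _ (Finset.measurable_sum _ fun i _ => (hℓy i).ennreal_ofReal),
      lintegral_finsetSum _ fun i _ => (hℓy i).ennreal_ofReal]
  have hsmh : 0 ≤ s * m * h := by positivity
  let ε := ENNReal.ofReal (Real.exp (s * m * h))
  have hevent : {ω | ∀ i, ENNReal.ofReal h ≤ shotNoise (Φ ω) ℓ (y i)} ⊆
      {ω | ε ≤ expE (∫⁻ x, f x ∂Φ ω)} := fun ω hω => by
    simp only [Set.mem_ofPred_eq, ε]
    rw [← expE_ofReal hsmh, hshot]
    refine expE_mono ?_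
    calc ENNReal.ofReal (s * m * h) = ENNReal.ofReal s * ∑ _i : Fin m, ENNReal.ofReal h := by
          rw [mul_assoc, ENNReal.ofReal_mul hs.le, ENNReal.ofReal_mul m.cast_nonneg]
          simp
      _ ≤ _ := by gcongr with i; exact hω i
  have hmarkov := mul_meas_ge_le_lintegral (μ := P) (continuous_expE.measurable.comp
    ((Measure.measurable_lintegral hf).comp hΦmeas)) ε
  rw [Real.exp_neg, ENNReal.ofReal_inv_of_pos (Real.exp_pos _)]
  calc _ ≤ P {ω | ε ≤ expE (∫⁻ x, f x ∂Φ ω)} := measure_mono hevent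
    _ = ε⁻¹ * (ε * P {ω | ε ≤ expE (∫⁻ x, f x ∂Φ ω)}) := by
      rw [← mul_assoc, ENNReal.inv_mul_cancel (by simp [Real.exp_pos]) ENNReal.ofReal_ne_top,
        one_mul]
    _ ≤ _ := by gcongr; exact hmarkov.trans hmoment
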